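/- arXiv:1508.00922 — 3 statements merged into one kernel-verified Lean document; each statement's English description precedes it below -/
import Mathlib

section
/- Let q > 0 and let A, Θ be invertible m×m real matrices and U, U_q be m×m real matrices such that W := qA⁻¹ − ΘU_q is invertible. Let P_0, P_1, Ψ_q, Ψ : (0,∞) → m×m real matrices satisfy, as λ → ∞ (entrywise): √λ·P_0(λ) → qA⁻¹, √λ·(I − P_1(λ)) → qA⁻¹, √λ·(Ψ_q(λ) − I) → ΘU_q, and √λ·(Ψ(λ) − I) → ΘU. Then for all sufficiently large λ the matrix I − P_1(λ)Ψ_q(λ) is invertible, and Φ(λ) := I − (I − P_1(λ)Ψ_q(λ))⁻¹(I − P_0(λ) − P_1(λ)Ψ(λ)) converges to I + (qA⁻¹ − ΘU_q)⁻¹ΘU as λ → ∞. -/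
open Matrix Filter Topology

/-- If `c • (1 - P)` converges while the scalars `c` tend to infinity, then `P` tends to `1`. -/
theorem tendsto_one_of_tendsto_smul_one_sub {α n : Type*} [DecidableEq n]
    {l : Filter α} {c : α → ℝ} {P : α → Matrix n n ℝ} {L : Matrix n n ℝ}
    (hc : Tendsto c l atTop) (h : Tendsto (fun x => c x • (1 - P x)) l (𝓝 L)) :
    Tendsto P l (𝓝 1) := by
  have hlim := (tendsto_const_nhds (x := (1 : Matrix n n ℝ))).sub (hc.inv_tendsto_atTop.smul h)
  rw [zero_smul, sub_zero] at hlim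
  refine hlim.congr' ?_
  filter_upwards [hc.eventually_ne_atTop 0] with x hx
  simp [smul_smul, hx]

/-- Inversion of real matrices is continuous along nets converging to an invertible matrix. -/
theorem tendsto_matrix_inv {α n : Type*} [Fintype n] [DecidableEq n] {l : Filter α}
    {M : α → Matrix n n ℝ} {W : Matrix n n ℝ} (hW : IsUnit W) (h : Tendsto M l (𝓝 W)) :
    Tendsto (fun x => (M x)⁻¹) l (𝓝 W⁻¹) := by
  have hdet : W.det ≠ 0 := ((Matrix.isUnit_iff_isUnit_det W).mp hW).ne_zero
  refine (continuousAt_matrix_inv W ?_).tendsto.comp h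
  rw [Ring.inverse_eq_inv']
  exact continuousAt_inv₀ hdet

/-- Matrices converging to an invertible matrix are eventually invertible. -/
theorem eventually_isUnit_of_tendsto {α n : Type*} [Fintype n] [DecidableEq n] {l : Filter α}
    {M : α → Matrix n n ℝ} {W : Matrix n n ℝ} (hW : IsUnit W) (h : Tendsto M l (𝓝 W)) :
    ∀ᶠ x in l, IsUnit (M x) := by
  have hdet : W.det ≠ 0 := ((Matrix.isUnit_iff_isUnit_det W).mp hW).ne_zero
  have hlim : Tendsto (fun x => (M x).det) l (𝓝 W.det) :=
    (continuous_id.matrix_det.tendsto W).comp h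
  filter_upwards [hlim.eventually_ne hdet] with x hx
  exact (Matrix.isUnit_iff_isUnit_det _).mpr hx.isUnit

/-- Convergence of the regeneration-epoch phase transition matrices for the
fluid queues approximating an MMBM with sticky boundary: under the stated
first-order asymptotics of `P₀, P₁, Ψq, Ψ`, the matrix `I − P₁(λ)Ψq(λ)` is
eventually invertible and
`Φ(λ) = I − (I − P₁Ψq)⁻¹(I − P₀ − P₁Ψ) → I + (qA⁻¹ − ΘUq)⁻¹ΘU`. -/
theorem stmt8 (m : ℕ) (q : ℝ) (hq : 0 < q)
    (A Θ U Uq : Matrix (Fin m) (Fin m) ℝ)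
    (hA : IsUnit A) (hΘ : IsUnit Θ)
    (hW : IsUnit (q • A⁻¹ - Θ * Uq))
    (P₀ P₁ Ψq Ψ : ℝ → Matrix (Fin m) (Fin m) ℝ)
    (h₀ : Tendsto (fun lam : ℝ => Real.sqrt lam • P₀ lam) atTop (𝓝 (q • A⁻¹)))
    (h₁ : Tendsto (fun lam : ℝ => Real.sqrt lam • (1 - P₁ lam)) atTop
      (𝓝 (q • A⁻¹)))
    (hΨq : Tendsto (fun lam : ℝ => Real.sqrt lam • (Ψq lam - 1)) atTop
      (𝓝 (Θ * Uq)))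
    (hΨ : Tendsto (fun lam : ℝ => Real.sqrt lam • (Ψ lam - 1)) atTop
      (𝓝 (Θ * U))) :
    (∀ᶠ lam : ℝ in atTop, IsUnit (1 - P₁ lam * Ψq lam)) ∧
    Tendsto (fun lam : ℝ =>
        1 - (1 - P₁ lam * Ψq lam)⁻¹ * (1 - P₀ lam - P₁ lam * Ψ lam)) atTop
      (𝓝 (1 + (q • A⁻¹ - Θ * Uq)⁻¹ * (Θ * U))) := by
  have hc : Tendsto Real.sqrt atTop atTop := Real.tendsto_sqrt_atTop
  have hP₁ : Tendsto P₁ atTop (𝓝 1) := tendsto_one_of_tendsto_smul_one_sub hc h₁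
  have hD : Tendsto (fun lam : ℝ => Real.sqrt lam • (1 - P₁ lam * Ψq lam)) atTop
      (𝓝 (q • A⁻¹ - Θ * Uq)) := by
    have h := h₁.sub (hP₁.mul hΨq)
    rw [one_mul] at h
    refine h.congr fun lam => ?_
    rw [mul_smul_comm, ← smul_sub, mul_sub, mul_one]
    congr 1
    abel
  have hN : Tendsto (fun lam : ℝ => Real.sqrt lam • (1 - P₀ lam - P₁ lam * Ψ lam)) atTop
      (𝓝 (-(Θ * U))) := by
    have h := (h₁.sub h₀).sub (hP₁.mul hΨ)
    rw [one_mul, sub_self, zero_sub] at h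
    refine h.congr fun lam => ?_
    rw [mul_smul_comm, ← smul_sub, ← smul_sub, mul_sub, mul_one]
    congr 1
    abel
  have hunit : ∀ᶠ lam : ℝ in atTop, IsUnit (1 - P₁ lam * Ψq lam) := by
    filter_upwards [eventually_isUnit_of_tendsto hW hD, hc.eventually_ne_atTop 0] with lam h hne
    exact (isUnit_smul_iff (Units.mk0 _ hne) _).mp h
  refine ⟨hunit, ?_⟩
  have hlim := (tendsto_const_nhds (x := (1 : Matrix (Fin m) (Fin m) ℝ))).sub
    ((tendsto_matrix_inv hW hD).mul hN)
  rw [mul_neg, sub_neg_eq_add] at hlim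
  refine hlim.congr' ?_
  filter_upwards [hunit, hc.eventually_ne_atTop 0] with lam h hne
  have hinv : (Real.sqrt lam • (1 - P₁ lam * Ψq lam))⁻¹
      = (Real.sqrt lam)⁻¹ • (1 - P₁ lam * Ψq lam)⁻¹ :=
    Matrix.inv_smul' _ (Units.mk0 _ hne) ((Matrix.isUnit_iff_isUnit_det _).mp h)
  rw [hinv, smul_mul_smul_comm, inv_mul_cancel₀ hne, one_smul]
end

section
/- Let q > 0, let Θ be an invertible m×m real matrix, and let U, U_q be m×m real matrices with U_q invertible. Let P_0, P_1, Ψ_q, Ψ : (0,∞) → m×m real matrices satisfy, as λ → ∞ (entrywise): √λ·P_0(λ) → 0, √λ·(I − P_1(λ)) → 0, √λ·(Ψ_q(λ) − I) → ΘU_q, and √λ·(Ψ(λ) − I) → ΘU. Then for all sufficiently large λ the matrix I − P_1(λ)Ψ_q(λ) is invertible, and Φ(λ) := I − (I − P_1(λ)Ψ_q(λ))⁻¹(I − P_0(λ) − P_1(λ)Ψ(λ)) converges to I − U_q⁻¹U as λ → ∞. -/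
open Matrix Filter Topology

/-- Matrix inversion over a topological field is continuous at invertible matrices. -/
theorem Filter.Tendsto.matrix_inv_of_isUnit {α n K : Type*} [Fintype n] [DecidableEq n]
    [Field K] [TopologicalSpace K] [IsTopologicalRing K] [ContinuousInv₀ K]
    {l : Filter α} {A : α → Matrix n n K} {A₀ : Matrix n n K}
    (hA : Tendsto A l (𝓝 A₀)) (hA₀ : IsUnit A₀) :
    Tendsto (fun x => (A x)⁻¹) l (𝓝 A₀⁻¹) := by
  have hdet : A₀.det ≠ 0 := ((Matrix.isUnit_iff_isUnit_det A₀).mp hA₀).ne_zero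
  simp only [Matrix.inv_def, Ring.inverse_eq_inv']
  have h₁ : Tendsto (fun x => (A x).det) l (𝓝 A₀.det) :=
    (continuous_id.matrix_det.tendsto A₀).comp hA
  have h₂ : Tendsto (fun x => (A x).adjugate) l (𝓝 A₀.adjugate) :=
    (continuous_id.matrix_adjugate.tendsto A₀).comp hA
  exact (h₁.inv₀ hdet).smul h₂

/-- Matrices converging to an invertible matrix are eventually invertible. -/
theorem Filter.Tendsto.eventually_isUnit_matrix {α n K : Type*} [Fintype n] [DecidableEq n]
    [Field K] [TopologicalSpace K] [IsTopologicalRing K] [T1Space K]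
    {l : Filter α} {A : α → Matrix n n K} {A₀ : Matrix n n K}
    (hA : Tendsto A l (𝓝 A₀)) (hA₀ : IsUnit A₀) :
    ∀ᶠ x in l, IsUnit (A x) := by
  have h : Tendsto (fun x => (A x).det) l (𝓝 A₀.det) :=
    (continuous_id.matrix_det.tendsto A₀).comp hA
  filter_upwards [h.eventually_ne ((Matrix.isUnit_iff_isUnit_det A₀).mp hA₀).ne_zero] with x hx
  exact (Matrix.isUnit_iff_isUnit_det _).mpr (isUnit_iff_ne_zero.mpr hx)

/-- A family whose difference from a point vanishes even after scaling by a factor tending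
to infinity converges to that point. -/
theorem tendsto_of_tendsto_smul_sub {α E : Type*} [AddCommGroup E] [Module ℝ E]
    [TopologicalSpace E] [IsTopologicalAddGroup E] [ContinuousSMul ℝ E]
    {l : Filter α} {r : α → ℝ} {f : α → E} {a b : E} (hr : Tendsto r l atTop)
    (h : Tendsto (fun x => r x • (a - f x)) l (𝓝 b)) : Tendsto f l (𝓝 a) := by
  have h₁ := tendsto_const_nhds (x := a).sub (hr.inv_tendsto_atTop.smul h)
  rw [zero_smul, sub_zero] at h₁
  refine h₁.congr' ?_
  filter_upwards [hr.eventually_ne_atTop 0] with x hx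
  simp [smul_smul, hx]

/-- Convergence of the regeneration-epoch phase transition matrices for the
fluid queues approximating the standard regulated MMBM: under the stated
asymptotics of `P₀, P₁, Ψq, Ψ`, the matrix `I − P₁(λ)Ψq(λ)` is eventually
invertible and `Φ(λ) = I − (I − P₁Ψq)⁻¹(I − P₀ − P₁Ψ) → I − Uq⁻¹U`. -/
theorem stmt9 (m : ℕ) (q : ℝ) (hq : 0 < q)
    (Θ U Uq : Matrix (Fin m) (Fin m) ℝ)
    (hΘ : IsUnit Θ) (hUq : IsUnit Uq)
    (P₀ P₁ Ψq Ψ : ℝ → Matrix (Fin m) (Fin m) ℝ)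
    (h₀ : Tendsto (fun lam : ℝ => Real.sqrt lam • P₀ lam) atTop (𝓝 0))
    (h₁ : Tendsto (fun lam : ℝ => Real.sqrt lam • (1 - P₁ lam)) atTop (𝓝 0))
    (hΨq : Tendsto (fun lam : ℝ => Real.sqrt lam • (Ψq lam - 1)) atTop
      (𝓝 (Θ * Uq)))
    (hΨ : Tendsto (fun lam : ℝ => Real.sqrt lam • (Ψ lam - 1)) atTop
      (𝓝 (Θ * U))) :
    (∀ᶠ lam : ℝ in atTop, IsUnit (1 - P₁ lam * Ψq lam)) ∧
    Tendsto (fun lam : ℝ =>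
        1 - (1 - P₁ lam * Ψq lam)⁻¹ * (1 - P₀ lam - P₁ lam * Ψ lam)) atTop
      (𝓝 (1 - Uq⁻¹ * U)) := by
  have hsqrt := Real.tendsto_sqrt_atTop
  have hP₁ : Tendsto P₁ atTop (𝓝 1) := tendsto_of_tendsto_smul_sub hsqrt h₁
  have hA : Tendsto (fun lam : ℝ => Real.sqrt lam • (1 - P₁ lam * Ψq lam)) atTop
      (𝓝 (-(Θ * Uq))) := by
    have h := h₁.sub (hP₁.mul hΨq)
    rw [one_mul, zero_sub] at h
    refine h.congr fun lam => ?_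
    rw [mul_smul_comm, ← smul_sub]
    congr 1
    noncomm_ring
  have hB : Tendsto (fun lam : ℝ => Real.sqrt lam • (1 - P₀ lam - P₁ lam * Ψ lam)) atTop
      (𝓝 (-(Θ * U))) := by
    have h := (h₁.sub h₀).sub (hP₁.mul hΨ)
    rw [one_mul, sub_zero, zero_sub] at h
    refine h.congr fun lam => ?_
    rw [mul_smul_comm, ← smul_sub, ← smul_sub]
    congr 1
    noncomm_ring
  have hunit : IsUnit (-(Θ * Uq)) := (hΘ.mul hUq).neg
  have hpos : ∀ᶠ lam : ℝ in atTop, Real.sqrt lam ≠ 0 := hsqrt.eventually_ne_atTop 0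
  constructor
  · filter_upwards [hA.eventually_isUnit_matrix hunit, hpos] with lam hlam hne
    exact (isUnit_smul_iff (Units.mk0 _ hne) _).mp hlam
  · have hlim : (-(Θ * Uq))⁻¹ * -(Θ * U) = Uq⁻¹ * U := by
      have hdet := (Matrix.isUnit_iff_isUnit_det _).mp hunit
      have hdetq := (Matrix.isUnit_iff_isUnit_det _).mp hUq
      have h : -(Θ * U) = -(Θ * Uq) * (Uq⁻¹ * U) := by
        rw [neg_mul, mul_assoc, Matrix.mul_nonsing_inv_cancel_left _ _ hdetq]
      rw [h, Matrix.nonsing_inv_mul_cancel_left _ _ hdet]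
    refine tendsto_const_nhds.sub ?_
    rw [← hlim]
    refine ((hA.matrix_inv_of_isUnit hunit).mul hB).congr' ?_
    filter_upwards [hA.eventually_isUnit_matrix hunit, hpos] with lam hlam hne
    have hM := (isUnit_smul_iff (Units.mk0 _ hne) _).mp hlam
    have hdet := (Matrix.isUnit_iff_isUnit_det _).mp hM
    have hinv := Matrix.inv_smul' (Units.mk0 _ hne) hdet (A := 1 - P₁ lam * Ψq lam)
    simp only [Units.smul_def, Units.val_mk0, Units.val_inv_eq_inv_val] at hinv
    rw [hinv, smul_mul_smul_comm, inv_mul_cancel₀ hne, one_smul]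
end

section
/- Let q be a real number, let B be an m×m real matrix with B𝟙 = 𝟙, let β be a row vector with βB = β, let Ã be an invertible m×m real matrix, and let Θ, U, U_q be m×m real matrices. Suppose a row vector ρ̃ and an m×m matrix Φ' satisfy Φ' = q(−Ã)⁻¹ + BΘ(U − U_q) + BΦ' + BΘU_q𝟙·ρ̃ + qÃ⁻¹B𝟙·ρ̃. Then β(q(−Ã)⁻¹ + Θ(U − U_q)) + (βΘU_q𝟙 + qβÃ⁻¹𝟙)·ρ̃ = 0. If moreover U𝟙 = 0 and the scalar c := β(q(−Ã)⁻¹ − ΘU_q)𝟙 is nonzero, then ρ̃ = c⁻¹·β(q(−Ã)⁻¹ + Θ(U − U_q)). -/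
open Matrix

/-- Perturbation-expansion step identifying the stationary distribution `ρ̃` at
regeneration epochs for the MMBM with sticky boundary and resampling: from the
matrix equation for `Φ'`, premultiplication by `β` (with `βB = β`, `B𝟙 = 𝟙`)
yields `β(q(−Ã)⁻¹ + Θ(U − Uq)) + (βΘUq𝟙 + qβÃ⁻¹𝟙)ρ̃ = 0`; if moreover
`U𝟙 = 0` and `c = β(q(−Ã)⁻¹ − ΘUq)𝟙 ≠ 0`, then
`ρ̃ = c⁻¹·β(q(−Ã)⁻¹ + Θ(U − Uq))`.  Here `At` stands for `Ã`. -/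
theorem stmt15 (m : ℕ) (q : ℝ)
    (B At Θ U Uq : Matrix (Fin m) (Fin m) ℝ)
    (hB1 : B *ᵥ (fun _ => (1 : ℝ)) = fun _ => 1)
    (β : Fin m → ℝ) (hβ : β ᵥ* B = β)
    (hAt : IsUnit At)
    (ρ : Fin m → ℝ) (Φ' : Matrix (Fin m) (Fin m) ℝ)
    (hΦ' : Φ' = q • (-At)⁻¹ + B * (Θ * (U - Uq)) + B * Φ'
      + Matrix.vecMulVec ((B * (Θ * Uq)) *ᵥ (fun _ => 1)) ρ
      + q • Matrix.vecMulVec ((At⁻¹ * B) *ᵥ (fun _ => 1)) ρ) :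
    β ᵥ* (q • (-At)⁻¹ + Θ * (U - Uq))
        + (β ⬝ᵥ ((Θ * Uq) *ᵥ (fun _ => 1))
            + q * (β ⬝ᵥ (At⁻¹ *ᵥ (fun _ => 1)))) • ρ = 0 ∧
    (U *ᵥ (fun _ => (1 : ℝ)) = 0 →
      ∀ c : ℝ, c = β ⬝ᵥ ((q • (-At)⁻¹ - Θ * Uq) *ᵥ (fun _ => 1)) → c ≠ 0 →
        ρ = c⁻¹ • (β ᵥ* (q • (-At)⁻¹ + Θ * (U - Uq)))) := by
  have h_inv : (-At)⁻¹ = -At⁻¹ := by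
    apply Matrix.inv_eq_right_inv
    rw [neg_mul_neg, Matrix.mul_nonsing_inv _ ((Matrix.isUnit_iff_isUnit_det _).mp hAt)]
  have h_balance : β ᵥ* (q • (-At)⁻¹ + Θ * (U - Uq))
      + (β ⬝ᵥ ((Θ * Uq) *ᵥ (fun _ => 1))
          + q * (β ⬝ᵥ (At⁻¹ *ᵥ (fun _ => 1)))) • ρ = 0 := by
    have h := congrArg (fun M => β ᵥ* M) hΦ'
    simp only [Matrix.vecMul_add, Matrix.vecMul_smul, Matrix.vecMul_vecMulVec,
      ← Matrix.vecMul_vecMul β B, ← Matrix.mulVec_mulVec _ _ B,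
      ← Matrix.mulVec_mulVec _ B, hβ, hB1] at h
    rw [Matrix.dotProduct_mulVec β B, hβ] at h
    rw [Matrix.vecMul_add, Matrix.vecMul_smul, add_smul, mul_smul]
    funext i
    have hi := congrFun h i
    simp only [Pi.add_apply, Pi.smul_apply, Pi.zero_apply, smul_eq_mul] at hi ⊢
    linarith
  refine ⟨h_balance, fun _ c hc hc0 => ?_⟩
  have h_coeff : β ⬝ᵥ ((Θ * Uq) *ᵥ (fun _ => 1))
      + q * (β ⬝ᵥ (At⁻¹ *ᵥ (fun _ => 1))) = -c := by
    rw [hc, h_inv, Matrix.sub_mulVec, Matrix.smul_mulVec, Matrix.neg_mulVec,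
      dotProduct_sub, dotProduct_smul, dotProduct_neg, smul_eq_mul]
    ring
  rw [h_coeff, neg_smul, add_neg_eq_zero] at h_balance
  rw [h_balance, inv_smul_smul₀ hc0]
end
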